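/- arXiv:2311.16457 — 9 statements merged into one kernel-verified Lean document; each statement's English description precedes it below -/
import Mathlib

section
/- Suppose N₁+N₂ ≥ 1 and N₃+N₄ ≥ 1, and set p = P/(P+Q) and q = Q/(P+Q). Then p·r⁻¹ + q·r = 1 + (r − r⁻¹)·ε, and moreover (r − r⁻¹)·ε ≥ 0 for every r > 0, so that p·r⁻¹ + q·r ≥ 1. (Eqs. (4.5)–(4.6): the expected one-step multiplicative change of Y = r^{−X}, where X is the number of mutants in the complete-graph layer, is at least 1.) -/
/-- With `P`, `Q`, `ε` as in the proof of Lemma 3 and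
`p = P/(P+Q)`, `q = Q/(P+Q)`, if `N₁+N₂ ≥ 1` and `N₃+N₄ ≥ 1` then
`p·r⁻¹ + q·r = 1 + (r − r⁻¹)·ε`, and `(r − r⁻¹)·ε ≥ 0` for every `r > 0`,
so that `p·r⁻¹ + q·r ≥ 1` (Eqs. (4.5)–(4.6)). -/
theorem stmt1 (r : ℝ) (hr : 0 < r) (N₁ N₂ N₃ N₄ : ℕ)
    (h12 : 1 ≤ N₁ + N₂) (h34 : 1 ≤ N₃ + N₄) :
    let P : ℝ := (2 * r * (N₁ : ℝ) + (r + 1) * (N₂ : ℝ)) * ((N₃ : ℝ) + (N₄ : ℝ))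
    let Q : ℝ := ((r + 1) * (N₃ : ℝ) + 2 * (N₄ : ℝ)) * ((N₁ : ℝ) + (N₂ : ℝ))
    let ε : ℝ := (r - 1) * (r * (N₁ : ℝ) * (N₃ : ℝ) + (r + 1) * (N₂ : ℝ) * (N₃ : ℝ)
      + (N₂ : ℝ) * (N₄ : ℝ)) / ((r + 1) * (P + Q))
    let p : ℝ := P / (P + Q)
    let q : ℝ := Q / (P + Q)
    p * r⁻¹ + q * r = 1 + (r - r⁻¹) * ε ∧
    (r - r⁻¹) * ε ≥ 0 ∧
    p * r⁻¹ + q * r ≥ 1 := by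
  intro P Q ε p q
  have h1 : (1:ℝ) ≤ (N₁:ℝ) + N₂ := by exact_mod_cast h12
  have h3 : (1:ℝ) ≤ (N₃:ℝ) + N₄ := by exact_mod_cast h34
  have n1 : (0:ℝ) ≤ N₁ := Nat.cast_nonneg _
  have n2 : (0:ℝ) ≤ N₂ := Nat.cast_nonneg _
  have n3 : (0:ℝ) ≤ N₃ := Nat.cast_nonneg _
  have n4 : (0:ℝ) ≤ N₄ := Nat.cast_nonneg _
  have hP : 0 ≤ P := by positivity
  have hQ : 0 < Q := by
    have h : 0 < (r + 1) * (N₃ : ℝ) + 2 * (N₄ : ℝ) := by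
      have := mul_nonneg hr.le n3
      nlinarith
    exact mul_pos h (by linarith)
  have hPQ : 0 < P + Q := by linarith
  obtain ⟨E, hE⟩ : ∃ E : ℝ, E = r * (N₁ : ℝ) * (N₃ : ℝ) + (r + 1) * (N₂ : ℝ) * (N₃ : ℝ)
      + (N₂ : ℝ) * (N₄ : ℝ) := ⟨_, rfl⟩
  have hE0 : 0 ≤ E := by rw [hE]; positivity
  have hkey : r * Q - P = (r - 1) * E := by
    rw [hE]; simp only [P, Q]; ring
  have hε : ε = (r - 1) * E / ((r + 1) * (P + Q)) := by rw [hE]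
  have h2 : (r - r⁻¹) * ε = (r - 1) ^ 2 * E / (r * (P + Q)) := by
    rw [hε]
    have : r + 1 ≠ 0 := by positivity
    have := hPQ.ne'
    clear_value P Q
    field_simp
    ring
  have hnn : (r - r⁻¹) * ε ≥ 0 := by rw [h2]; positivity
  have heq : p * r⁻¹ + q * r = 1 + (r - r⁻¹) * ε := by
    rw [h2]
    have := hPQ.ne'
    simp only [p, q]
    clear_value P Q
    field_simp
    linear_combination (r - 1) * hkey
  exact ⟨heq, hnn, by rw [heq]; linarith⟩
end

section
/- Suppose N ≥ 2. Then p′·r⁻¹ + q′·r + (1 − p′ − q′) ≥ 1; equivalently, p′·(r⁻¹ − 1) + q′·(r − 1) ≥ 0. (This is the one-step submartingale property of Y = r^{−X}, where X is the number of mutants in the complete-graph layer, which is the content of Lemma 3: the sequence Yₜ = r^{−Xₜ} is a submartingale for any r > 0 when layer 1 is the unweighted complete graph and layer 2 is arbitrary.) -/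
/-- With `F`, `p′`, `q′` as in Eqs. (4.1)–(4.2) (birth–death process
of model 1, complete-graph layer of a two-layer network), if `N ≥ 2` then
`p′·r⁻¹ + q′·r + (1 − p′ − q′) ≥ 1`; equivalently,
`p′·(r⁻¹ − 1) + q′·(r − 1) ≥ 0` (the one-step submartingale property of
`Y = r^{−X}`, i.e., Lemma 3). -/
theorem stmt3 (r : ℝ) (hr : 0 < r) (N₁ N₂ N₃ N₄ : ℕ)
    (hN : 2 ≤ N₁ + N₂ + N₃ + N₄) :
    let N : ℕ := N₁ + N₂ + N₃ + N₄
    let F : ℝ := 2 * r * (N₁ : ℝ) + (r + 1) * ((N₂ : ℝ) + (N₃ : ℝ)) + 2 * (N₄ : ℝ)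
    let p' : ℝ := (2 * r * (N₁ : ℝ) + (r + 1) * (N₂ : ℝ)) / F * (1 / 2)
      * (((N₃ : ℝ) + (N₄ : ℝ)) / ((N : ℝ) - 1))
    let q' : ℝ := ((r + 1) * (N₃ : ℝ) + 2 * (N₄ : ℝ)) / F * (1 / 2)
      * (((N₁ : ℝ) + (N₂ : ℝ)) / ((N : ℝ) - 1))
    p' * r⁻¹ + q' * r + (1 - p' - q') ≥ 1 ∧
    p' * (r⁻¹ - 1) + q' * (r - 1) ≥ 0 := by
  intro N F p' q'
  have hF : 0 ≤ F⁻¹ := by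
    apply inv_nonneg.mpr
    positivity
  have hM : 0 ≤ ((N : ℝ) - 1)⁻¹ := by
    apply inv_nonneg.mpr
    have h : (2 : ℝ) ≤ (N : ℝ) := by exact_mod_cast hN
    linarith
  have key : p' * (r⁻¹ - 1) + q' * (r - 1) =
      (r - 1) ^ 2 * (r * N₁ * N₃ + (r + 1) * N₂ * N₃ + N₂ * N₄) * r⁻¹ * (1 / 2)
        * F⁻¹ * ((N : ℝ) - 1)⁻¹ := by
    simp only [p', q', div_eq_mul_inv]
    generalize F⁻¹ = f
    generalize ((N : ℝ) - 1)⁻¹ = m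
    field_simp
    ring
  have h2 : p' * (r⁻¹ - 1) + q' * (r - 1) ≥ 0 := by
    rw [key]
    positivity
  exact ⟨by linarith, h2⟩
end

section
/- Suppose N ≥ 2, r ≠ 1, N₁+N₂ ≥ 1, N₃+N₄ ≥ 1 and N₂+N₃ ≥ 1. Then p′·r⁻¹ + q′·r + (1 − p′ − q′) > 1. (The strict one-step submartingale inequality used in the proof of Theorem 4, which shows that the complete-graph layer of a two-layer network is a suppressor of selection.) -/
/-- With `F`, `p′`, `q′` as in Eqs. (4.1)–(4.2), if `N ≥ 2`,
`r ≠ 1`, `N₁+N₂ ≥ 1`, `N₃+N₄ ≥ 1` and `N₂+N₃ ≥ 1`, then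
`p′·r⁻¹ + q′·r + (1 − p′ − q′) > 1` (the strict one-step submartingale
inequality used in the proof of Theorem 4). -/
theorem stmt4 (r : ℝ) (hr : 0 < r) (hr1 : r ≠ 1) (N₁ N₂ N₃ N₄ : ℕ)
    (hN : 2 ≤ N₁ + N₂ + N₃ + N₄)
    (h12 : 1 ≤ N₁ + N₂) (h34 : 1 ≤ N₃ + N₄) (h23 : 1 ≤ N₂ + N₃) :
    let N : ℕ := N₁ + N₂ + N₃ + N₄
    let F : ℝ := 2 * r * (N₁ : ℝ) + (r + 1) * ((N₂ : ℝ) + (N₃ : ℝ)) + 2 * (N₄ : ℝ)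
    let p' : ℝ := (2 * r * (N₁ : ℝ) + (r + 1) * (N₂ : ℝ)) / F * (1 / 2)
      * (((N₃ : ℝ) + (N₄ : ℝ)) / ((N : ℝ) - 1))
    let q' : ℝ := ((r + 1) * (N₃ : ℝ) + 2 * (N₄ : ℝ)) / F * (1 / 2)
      * (((N₁ : ℝ) + (N₂ : ℝ)) / ((N : ℝ) - 1))
    p' * r⁻¹ + q' * r + (1 - p' - q') > 1 := by
  intro N F p' q'
  have hS : 0 < r * (N₁ * N₃ : ℝ) + (r + 1) * (N₂ * N₃ : ℝ) + (N₂ * N₄ : ℝ) := by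
    rcases Nat.eq_zero_or_pos N₂ with h2 | h2
    · have h1 : (0 : ℝ) < N₁ := by exact_mod_cast (by omega : 0 < N₁)
      have h3 : (0 : ℝ) < N₃ := by exact_mod_cast (by omega : 0 < N₃)
      positivity
    · have h2' : (0 : ℝ) < N₂ := by exact_mod_cast h2
      rcases Nat.eq_zero_or_pos N₃ with h3 | h3
      · have h4 : (0 : ℝ) < N₄ := by exact_mod_cast (by omega : 0 < N₄)
        positivity
      · have h3' : (0 : ℝ) < N₃ := by exact_mod_cast h3
        positivity
  have hF : 0 < F := by
    have h : (0 : ℝ) < (N₂ : ℝ) + N₃ := by exact_mod_cast (by omega : 0 < N₂ + N₃)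
    positivity
  have hM : 0 < (N : ℝ) - 1 := by
    have h : (2 : ℝ) ≤ (N : ℝ) := by exact_mod_cast hN
    linarith
  have hd : 0 < (r - 1) ^ 2 := by
    have := sub_ne_zero.mpr hr1
    positivity
  have key : p' * r⁻¹ + q' * r + (1 - p' - q') - 1 =
      (r - 1) ^ 2 * (r * (N₁ * N₃ : ℝ) + (r + 1) * (N₂ * N₃ : ℝ) + (N₂ * N₄ : ℝ))
        / (2 * r * F * ((N : ℝ) - 1)) := by
    simp only [p', q']
    generalize (N : ℝ) - 1 = M at *
    clear_value F
    field_simp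
    ring
  have : 0 < p' * r⁻¹ + q' * r + (1 - p' - q') - 1 := by
    rw [key]
    positivity
  linarith
end

section
/- For every admissible choice of x₁, x₂, y₁, y₂ one has (a/(a+b))·r⁻¹ + (b/(a+b))·r = 1 + (r−1)(rb−a)/(r(a+b)), and (r−1)(rb−a) ≥ 0, so that (a/(a+b))·r⁻¹ + (b/(a+b))·r ≥ 1. (This unifies the nine cases in the proof of Lemma 6: the normalized one-step gain and loss probabilities p = a/(a+b) and q = b/(a+b) of the mutant segment on the cycle-graph layer satisfy p·r⁻¹ + q·r ≥ 1, i.e., Yₜ = r^{−Xₜ} is a submartingale.) -/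
/-- On the cycle-graph layer of a two-layer network, the endpoint
mutants have total fitnesses `x₁, x₂ ∈ {2r, r+1}` and the adjacent residents
have total fitnesses `y₁, y₂ ∈ {2, r+1}`. With `a = x₁+x₂` and `b = y₁+y₂`,
for every admissible choice one has
`(a/(a+b))·r⁻¹ + (b/(a+b))·r = 1 + (r−1)(rb−a)/(r(a+b))`, and
`(r−1)(rb−a) ≥ 0`, so that `(a/(a+b))·r⁻¹ + (b/(a+b))·r ≥ 1`
(unifying the nine cases in the proof of Lemma 6). -/
theorem stmt6 (r : ℝ) (hr : 0 < r) (x₁ x₂ y₁ y₂ : ℝ)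
    (hx1 : x₁ = 2 * r ∨ x₁ = r + 1) (hx2 : x₂ = 2 * r ∨ x₂ = r + 1)
    (hy1 : y₁ = 2 ∨ y₁ = r + 1) (hy2 : y₂ = 2 ∨ y₂ = r + 1) :
    let a : ℝ := x₁ + x₂
    let b : ℝ := y₁ + y₂
    a / (a + b) * r⁻¹ + b / (a + b) * r
      = 1 + (r - 1) * (r * b - a) / (r * (a + b)) ∧
    (r - 1) * (r * b - a) ≥ 0 ∧
    a / (a + b) * r⁻¹ + b / (a + b) * r ≥ 1 := by
  intro a b
  have key : ∀ x y : ℝ, (x = 2 * r ∨ x = r + 1) → (y = 2 ∨ y = r + 1) →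
      0 < x ∧ 0 < y ∧ 0 ≤ (r - 1) * (r * y - x) := by
    intro x y hx hy
    have h2 : 0 ≤ (r - 1) ^ 2 := sq_nonneg _
    have h3 : 0 ≤ r * (r - 1) ^ 2 := by positivity
    rcases hx with rfl | rfl <;> rcases hy with rfl | rfl <;>
      refine ⟨by linarith, by linarith, by nlinarith⟩
  obtain ⟨p1, q1, h1⟩ := key x₁ y₁ hx1 hy1
  obtain ⟨p2, q2, h2⟩ := key x₂ y₂ hx2 hy2
  have hs : 0 < a + b := by simp only [a, b]; linarith
  have hB : (r - 1) * (r * b - a) ≥ 0 := by simp only [a, b]; linarith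
  have hA : a / (a + b) * r⁻¹ + b / (a + b) * r
      = 1 + (r - 1) * (r * b - a) / (r * (a + b)) := by
    have := hs.ne'
    clear_value a b
    field_simp
    ring
  refine ⟨hA, hB, ?_⟩
  rw [hA]
  have : 0 ≤ (r - 1) * (r * b - a) / (r * (a + b)) := div_nonneg hB (mul_pos hr hs).le
  linarith
end

section
/- If r ≠ 1 and it is not the case that x₁ = x₂ = 2r and y₁ = y₂ = 2, then (r−1)(rb−a) > 0, and hence (a/(a+b))·r⁻¹ + (b/(a+b))·r > 1. (The strict one-step submartingale inequality in the eight non-neutral cases of Lemma 6, used in the proof of Theorem 7 that the cycle-graph layer of a two-layer network is a suppressor of selection.) -/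
/-- In the setting of Lemma 6 (cycle-graph layer), if `r ≠ 1` and
it is not the case that `x₁ = x₂ = 2r` and `y₁ = y₂ = 2`, then
`(r−1)(rb−a) > 0`, and hence `(a/(a+b))·r⁻¹ + (b/(a+b))·r > 1`
(the strict one-step submartingale inequality in the eight non-neutral cases,
used in the proof of Theorem 7). -/
theorem stmt7 (r : ℝ) (hr : 0 < r) (hr1 : r ≠ 1) (x₁ x₂ y₁ y₂ : ℝ)
    (hx1 : x₁ = 2 * r ∨ x₁ = r + 1) (hx2 : x₂ = 2 * r ∨ x₂ = r + 1)
    (hy1 : y₁ = 2 ∨ y₁ = r + 1) (hy2 : y₂ = 2 ∨ y₂ = r + 1)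
    (hcase : ¬(x₁ = 2 * r ∧ x₂ = 2 * r ∧ y₁ = 2 ∧ y₂ = 2)) :
    let a : ℝ := x₁ + x₂
    let b : ℝ := y₁ + y₂
    (r - 1) * (r * b - a) > 0 ∧
    a / (a + b) * r⁻¹ + b / (a + b) * r > 1 := by
  intro a b
  have hsq : 0 < (r - 1) ^ 2 := by
    have : r - 1 ≠ 0 := sub_ne_zero.mpr hr1
    positivity
  have hrsq : 0 < r * (r - 1) ^ 2 := mul_pos hr hsq
  have ha : 0 < a := by
    rcases hx1 with h | h <;> rcases hx2 with h' | h' <;> simp only [a, h, h'] <;> positivity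
  have hb : 0 < b := by
    rcases hy1 with h | h <;> rcases hy2 with h' | h' <;> simp only [b, h, h'] <;> positivity
  have key : (r - 1) * (r * b - a) > 0 := by
    rcases hx1 with h1 | h1 <;> rcases hx2 with h2 | h2 <;>
      rcases hy1 with h3 | h3 <;> rcases hy2 with h4 | h4 <;>
      first
        | (exfalso; apply hcase; refine And.intro ?_ (And.intro ?_ (And.intro ?_ ?_)) <;> assumption)
        | (simp only [a, b, h1, h2, h3, h4]; nlinarith [hsq, hrsq])
  refine ⟨key, ?_⟩
  have hab : 0 < a + b := add_pos ha hb
  have e : a / (a + b) * r⁻¹ + b / (a + b) * r - 1 =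
      (r - 1) * (r * b - a) / (r * (a + b)) := by
    have := hab.ne'
    have := hr.ne'
    field_simp
    ring
  have : 0 < (r - 1) * (r * b - a) / (r * (a + b)) := div_pos key (mul_pos hr hab)
  linarith
end

section
/- Let F > 0 be a real number with a + b ≤ 4F. Then (a/(4F))·r⁻¹ + (b/(4F))·r + (1 − (a+b)/(4F)) ≥ 1. (The raw one-step submartingale inequality for Y = r^{−X} on the cycle-graph layer, where one step of the original birth–death process increases X by one with probability a/(4F) and decreases it by one with probability b/(4F), F being the total fitness of the population; Lemma 6.) -/
theorem stmt8_aux (r : ℝ) (hr : 0 < r) (x y : ℝ)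
    (hx : x = 2 * r ∨ x = r + 1) (hy : y = 2 ∨ y = r + 1) :
    0 ≤ (1 - r) * (x - r * y) := by
  rcases hx with rfl | rfl <;> rcases hy with rfl | rfl
  · have : (1 - r) * (2 * r - r * 2) = 0 := by ring
    exact this.ge
  · have : (1 - r) * (2 * r - r * (r + 1)) = r * (1 - r) ^ 2 := by ring
    rw [this]; positivity
  · have : (1 - r) * (r + 1 - r * 2) = (1 - r) ^ 2 := by ring
    rw [this]; positivity
  · have : (1 - r) * (r + 1 - r * (r + 1)) = (r + 1) * (1 - r) ^ 2 := by ring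
    rw [this]; positivity

/-- In the setting of Lemma 6 (cycle-graph layer), let `F > 0` be
a real number with `a + b ≤ 4F`. Then
`(a/(4F))·r⁻¹ + (b/(4F))·r + (1 − (a+b)/(4F)) ≥ 1` (the raw one-step
submartingale inequality for `Y = r^{−X}` on the cycle-graph layer, `F` being
the total fitness of the population). -/
theorem stmt8 (r : ℝ) (hr : 0 < r) (x₁ x₂ y₁ y₂ : ℝ)
    (hx1 : x₁ = 2 * r ∨ x₁ = r + 1) (hx2 : x₂ = 2 * r ∨ x₂ = r + 1)
    (hy1 : y₁ = 2 ∨ y₁ = r + 1) (hy2 : y₂ = 2 ∨ y₂ = r + 1)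
    (F : ℝ) (hF : 0 < F)
    (hab : x₁ + x₂ + (y₁ + y₂) ≤ 4 * F) :
    let a : ℝ := x₁ + x₂
    let b : ℝ := y₁ + y₂
    a / (4 * F) * r⁻¹ + b / (4 * F) * r + (1 - (a + b) / (4 * F)) ≥ 1 := by
  intro a b
  have h1 := stmt8_aux r hr x₁ y₁ hx1 hy1
  have h2 := stmt8_aux r hr x₂ y₂ hx2 hy2
  have h3 : 0 ≤ ((1 - r) * (x₁ - r * y₁) + (1 - r) * (x₂ - r * y₂)) / (4 * F * r) := by
    positivity
  have h4 : a / (4 * F) * r⁻¹ + b / (4 * F) * r + (1 - (a + b) / (4 * F)) =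
      1 + ((1 - r) * (x₁ - r * y₁) + (1 - r) * (x₂ - r * y₂)) / (4 * F * r) := by
    simp only [a, b]
    field_simp
    ring
  rw [h4]
  linarith
end

section
/- For every r > 0, p₁′·(h₁−1) + p₂′·(h₂−1) + q₁′·(h₁⁻¹−1) + q₂′·(h₂⁻¹−1) ≥ 0; equivalently, p₁′h₁ + p₂′h₂ + q₁′/h₁ + q₂′/h₂ + (1 − p₁′ − p₂′ − q₁′ − q₂′) ≥ 1. (This is the one-step submartingale property of Yₜ = h₁^{X₁,ₜ}·h₂^{X₂,ₜ} under the birth–death process, which is the content of Lemma 8: when layer 1 is the unweighted complete bipartite graph and layer 2 is an arbitrary connected network, Yₜ is a submartingale for any r > 0.) -/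
theorem aux10 (r a b k c1 c2 c3 c4 d1 d2 d3 d4 : ℝ) (hr : 0 < r) (ha : 0 < a) (hb : 0 < b)
    (hk : 0 ≤ k) (h1 : 0 ≤ c1) (h2 : 0 ≤ c2) (h3 : 0 ≤ c3) (h4 : 0 ≤ c4)
    (g1 : 0 ≤ d1) (g2 : 0 ≤ d2) (g3 : 0 ≤ d3) (g4 : 0 ≤ d4) :
    0 ≤ (2 * r * d1 + (1 + r) * d2) * k * (1 / 2) * ((c3 + c4) / a)
          * ((a + b * r) / (a * r ^ 2 + b * r) - 1)
      + (2 * r * c1 + (1 + r) * c2) * k * (1 / 2) * ((d3 + d4) / b)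
          * ((b + a * r) / (b * r ^ 2 + a * r) - 1)
      + ((1 + r) * d3 + 2 * d4) * k * (1 / 2) * ((c1 + c2) / a)
          * (((a + b * r) / (a * r ^ 2 + b * r))⁻¹ - 1)
      + ((1 + r) * c3 + 2 * c4) * k * (1 / 2) * ((d1 + d2) / b)
          * (((b + a * r) / (b * r ^ 2 + a * r))⁻¹ - 1) := by
  have e1 : (a + b * r) / (a * r ^ 2 + b * r) - 1 = a * (1 - r ^ 2) / (r * (a * r + b)) := by
    have : a * r ^ 2 + b * r = r * (a * r + b) := by ring
    rw [this]
    have : a * r + b ≠ 0 := by positivity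
    field_simp
    ring
  have e2 : (b + a * r) / (b * r ^ 2 + a * r) - 1 = b * (1 - r ^ 2) / (r * (a + b * r)) := by
    have : b * r ^ 2 + a * r = r * (a + b * r) := by ring
    rw [this]
    have : a + b * r ≠ 0 := by positivity
    field_simp
    ring
  have e3 : ((a + b * r) / (a * r ^ 2 + b * r))⁻¹ - 1 = a * (r ^ 2 - 1) / (a + b * r) := by
    have : a + b * r ≠ 0 := by positivity
    rw [inv_div]
    field_simp
    ring
  have e4 : ((b + a * r) / (b * r ^ 2 + a * r))⁻¹ - 1 = b * (r ^ 2 - 1) / (a * r + b) := by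
    have : a * r + b ≠ 0 := by positivity
    rw [inv_div, add_comm b (a * r)]
    field_simp
    ring
  rw [e1, e2, e3, e4]
  have hu : 0 < a * r + b := by positivity
  have hv : 0 < a + b * r := by positivity
  generalize a * r + b = u at hu ⊢
  generalize a + b * r = v at hv ⊢
  have key : 0 ≤ k * (1 - r) ^ 2 * (1 + r) / (2 * r) *
      ((r * d1 * c3 + (1 + r) * d2 * c3 + d2 * c4) / u
        + (r * c1 * d3 + (1 + r) * c2 * d3 + c2 * d4) / v) := by positivity
  refine key.trans (le_of_eq ?_)
  field_simp
  ring

/-- With `h₁`, `h₂`, `G` and the one-step transition probabilities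
`p₁′`, `p₂′`, `q₁′`, `q₂′` of Eqs. (S1)–(S4) for the complete-bipartite layer of
a two-layer network, for every `r > 0` one has
`p₁′·(h₁−1) + p₂′·(h₂−1) + q₁′·(h₁⁻¹−1) + q₂′·(h₂⁻¹−1) ≥ 0`; equivalently,
`p₁′h₁ + p₂′h₂ + q₁′/h₁ + q₂′/h₂ + (1 − p₁′ − p₂′ − q₁′ − q₂′) ≥ 1`
(the one-step submartingale property of `Yₜ = h₁^{X₁,ₜ}·h₂^{X₂,ₜ}`, Lemma 8). -/
theorem stmt10 (r : ℝ) (hr : 0 < r) (N₁ N₂ : ℕ) (hN1 : 1 ≤ N₁) (hN2 : 1 ≤ N₂)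
    (C₁ C₂ C₃ C₄ D₁ D₂ D₃ D₄ : ℕ)
    (hC : C₁ + C₂ + C₃ + C₄ = N₁) (hD : D₁ + D₂ + D₃ + D₄ = N₂) :
    let h₁ : ℝ := ((N₁ : ℝ) + (N₂ : ℝ) * r) / ((N₁ : ℝ) * r ^ 2 + (N₂ : ℝ) * r)
    let h₂ : ℝ := ((N₂ : ℝ) + (N₁ : ℝ) * r) / ((N₂ : ℝ) * r ^ 2 + (N₁ : ℝ) * r)
    let G : ℝ := 2 * r * ((C₁ : ℝ) + (D₁ : ℝ))
      + (r + 1) * ((C₂ : ℝ) + (C₃ : ℝ) + (D₂ : ℝ) + (D₃ : ℝ))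
      + 2 * ((C₄ : ℝ) + (D₄ : ℝ))
    let p₁' : ℝ := (2 * r * (D₁ : ℝ) + (1 + r) * (D₂ : ℝ)) / G * (1 / 2)
      * (((C₃ : ℝ) + (C₄ : ℝ)) / (N₁ : ℝ))
    let p₂' : ℝ := (2 * r * (C₁ : ℝ) + (1 + r) * (C₂ : ℝ)) / G * (1 / 2)
      * (((D₃ : ℝ) + (D₄ : ℝ)) / (N₂ : ℝ))
    let q₁' : ℝ := ((1 + r) * (D₃ : ℝ) + 2 * (D₄ : ℝ)) / G * (1 / 2)
      * (((C₁ : ℝ) + (C₂ : ℝ)) / (N₁ : ℝ))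
    let q₂' : ℝ := ((1 + r) * (C₃ : ℝ) + 2 * (C₄ : ℝ)) / G * (1 / 2)
      * (((D₁ : ℝ) + (D₂ : ℝ)) / (N₂ : ℝ))
    p₁' * (h₁ - 1) + p₂' * (h₂ - 1) + q₁' * (h₁⁻¹ - 1) + q₂' * (h₂⁻¹ - 1) ≥ 0 ∧
    p₁' * h₁ + p₂' * h₂ + q₁' / h₁ + q₂' / h₂
      + (1 - p₁' - p₂' - q₁' - q₂') ≥ 1 := by
  intro h₁ h₂ G p₁' p₂' q₁' q₂'
  have hG : 0 ≤ G⁻¹ := by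
    simp only [G]
    positivity
  have ha : (0 : ℝ) < N₁ := by exact_mod_cast hN1
  have hb : (0 : ℝ) < N₂ := by exact_mod_cast hN2
  have main : 0 ≤ p₁' * (h₁ - 1) + p₂' * (h₂ - 1) + q₁' * (h₁⁻¹ - 1) + q₂' * (h₂⁻¹ - 1) :=
    aux10 r N₁ N₂ G⁻¹ C₁ C₂ C₃ C₄ D₁ D₂ D₃ D₄ hr ha hb hG
      (Nat.cast_nonneg _) (Nat.cast_nonneg _) (Nat.cast_nonneg _) (Nat.cast_nonneg _)
      (Nat.cast_nonneg _) (Nat.cast_nonneg _) (Nat.cast_nonneg _) (Nat.cast_nonneg _)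
  refine ⟨main, ?_⟩
  rw [div_eq_mul_inv q₁', div_eq_mul_inv q₂']
  linarith [main]
end

section
/- Assume δ > 0. Then p₁h₁ + p₂h₂ + q₁/h₁ + q₂/h₂ = 1 + (1−r)²(1+r)N₁N₂·{(N₁+N₂r)[rD₁C₃+(1+r)D₂C₃+D₂C₄] + (N₂+N₁r)[rC₁D₃+(1+r)C₂D₃+C₂D₄]} / [δ·N₁N₂·r·(N₁+N₂r)(N₂+N₁r)], and in particular p₁h₁ + p₂h₂ + q₁/h₁ + q₂/h₂ ≥ 1. (The explicit identity Eq. (S17) in the proof of Lemma 8.) -/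
theorem aux (r n m a b c d R δ : ℝ) (hr : 0 < r) (hn : 0 < n) (hm : 0 < m) (hδ : 0 < δ)
    (hd : δ = (1 / n) * (a + c) + (1 / m) * (b + d))
    (key : a / n * ((n + m * r) / (n * r ^ 2 + m * r)) + b / m * ((m + n * r) / (m * r ^ 2 + n * r))
      + c / n * ((n * r ^ 2 + m * r) / (n + m * r)) + d / m * ((m * r ^ 2 + n * r) / (m + n * r))
      = ((1 / n) * (a + c) + (1 / m) * (b + d)) + R / (r * (n + m * r) * (m + n * r))) :
    a / (δ * n) * ((n + m * r) / (n * r ^ 2 + m * r))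
      + b / (δ * m) * ((m + n * r) / (m * r ^ 2 + n * r))
      + c / (δ * n) / ((n + m * r) / (n * r ^ 2 + m * r))
      + d / (δ * m) / ((m + n * r) / (m * r ^ 2 + n * r))
      = 1 + R * n * m / (δ * n * m * r * (n + m * r) * (m + n * r)) := by
  rw [← hd] at key
  have e1 : n + m * r ≠ 0 := by positivity
  have e2 : m + n * r ≠ 0 := by positivity
  have e3 : n * r ^ 2 + m * r ≠ 0 := by positivity
  have e4 : m * r ^ 2 + n * r ≠ 0 := by positivity
  have hh : 1 + R * n * m / (δ * n * m * r * (n + m * r) * (m + n * r))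
      = (δ + R / (r * (n + m * r) * (m + n * r))) / δ := by
    field_simp
  rw [hh, ← key, div_div_eq_mul_div, div_div_eq_mul_div]
  generalize n + m * r = x1 at *
  generalize m + n * r = x2 at *
  generalize n * r ^ 2 + m * r = x3 at *
  generalize m * r ^ 2 + n * r = x4 at *
  field_simp

theorem aux2 (r n m C₁ C₂ C₃ C₄ D₁ D₂ D₃ D₄ : ℝ) (hr : 0 < r) (hn : 0 < n) (hm : 0 < m) :
    (2 * r * D₁ + (1 + r) * D₂) * (C₃ + C₄) / n * ((n + m * r) / (n * r ^ 2 + m * r))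
      + (2 * r * C₁ + (1 + r) * C₂) * (D₃ + D₄) / m * ((m + n * r) / (m * r ^ 2 + n * r))
      + ((1 + r) * D₃ + 2 * D₄) * (C₁ + C₂) / n * ((n * r ^ 2 + m * r) / (n + m * r))
      + ((1 + r) * C₃ + 2 * C₄) * (D₁ + D₂) / m * ((m * r ^ 2 + n * r) / (m + n * r))
      = ((1 / n) * ((2 * r * D₁ + (1 + r) * D₂) * (C₃ + C₄) + ((1 + r) * D₃ + 2 * D₄) * (C₁ + C₂))
        + (1 / m) * ((2 * r * C₁ + (1 + r) * C₂) * (D₃ + D₄)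
          + ((1 + r) * C₃ + 2 * C₄) * (D₁ + D₂)))
        + ((1 - r) ^ 2 * (1 + r) * ((n + m * r) * (r * D₁ * C₃ + (1 + r) * D₂ * C₃ + D₂ * C₄)
          + (m + n * r) * (r * C₁ * D₃ + (1 + r) * C₂ * D₃ + C₂ * D₄)))
          / (r * (n + m * r) * (m + n * r)) := by
  have e1 : n + m * r ≠ 0 := by positivity
  have e2 : m + n * r ≠ 0 := by positivity
  have e3 : n * r ^ 2 + m * r = r * (m + n * r) := by ring
  have e4 : m * r ^ 2 + n * r = r * (n + m * r) := by ring
  rw [e3, e4]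
  field_simp
  ring

/-- With `h₁`, `h₂`, `δ` and the normalized transition
probabilities `p₁`, `p₂`, `q₁`, `q₂` of Eqs. (S6)–(S9) for the
complete-bipartite layer, assuming `δ > 0`,
`p₁h₁ + p₂h₂ + q₁/h₁ + q₂/h₂ = 1 + (1−r)²(1+r)N₁N₂·{(N₁+N₂r)[rD₁C₃
+ (1+r)D₂C₃ + D₂C₄] + (N₂+N₁r)[rC₁D₃+(1+r)C₂D₃+C₂D₄]}
/ [δ·N₁N₂·r·(N₁+N₂r)(N₂+N₁r)]`, and in particular
`p₁h₁ + p₂h₂ + q₁/h₁ + q₂/h₂ ≥ 1` (Eq. (S17) in the proof of Lemma 8). -/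
theorem stmt11 (r : ℝ) (hr : 0 < r) (N₁ N₂ : ℕ) (hN1 : 1 ≤ N₁) (hN2 : 1 ≤ N₂)
    (C₁ C₂ C₃ C₄ D₁ D₂ D₃ D₄ : ℕ)
    (hC : C₁ + C₂ + C₃ + C₄ = N₁) (hD : D₁ + D₂ + D₃ + D₄ = N₂) :
    let h₁ : ℝ := ((N₁ : ℝ) + (N₂ : ℝ) * r) / ((N₁ : ℝ) * r ^ 2 + (N₂ : ℝ) * r)
    let h₂ : ℝ := ((N₂ : ℝ) + (N₁ : ℝ) * r) / ((N₂ : ℝ) * r ^ 2 + (N₁ : ℝ) * r)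
    let δ : ℝ := (1 / (N₁ : ℝ)) * ((2 * r * (D₁ : ℝ) + (1 + r) * (D₂ : ℝ)) * ((C₃ : ℝ) + (C₄ : ℝ))
        + ((1 + r) * (D₃ : ℝ) + 2 * (D₄ : ℝ)) * ((C₁ : ℝ) + (C₂ : ℝ)))
      + (1 / (N₂ : ℝ)) * ((2 * r * (C₁ : ℝ) + (1 + r) * (C₂ : ℝ)) * ((D₃ : ℝ) + (D₄ : ℝ))
        + ((1 + r) * (C₃ : ℝ) + 2 * (C₄ : ℝ)) * ((D₁ : ℝ) + (D₂ : ℝ)))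
    let p₁ : ℝ := (2 * r * (D₁ : ℝ) + (1 + r) * (D₂ : ℝ)) * ((C₃ : ℝ) + (C₄ : ℝ)) / (δ * (N₁ : ℝ))
    let p₂ : ℝ := (2 * r * (C₁ : ℝ) + (1 + r) * (C₂ : ℝ)) * ((D₃ : ℝ) + (D₄ : ℝ)) / (δ * (N₂ : ℝ))
    let q₁ : ℝ := ((1 + r) * (D₃ : ℝ) + 2 * (D₄ : ℝ)) * ((C₁ : ℝ) + (C₂ : ℝ)) / (δ * (N₁ : ℝ))
    let q₂ : ℝ := ((1 + r) * (C₃ : ℝ) + 2 * (C₄ : ℝ)) * ((D₁ : ℝ) + (D₂ : ℝ)) / (δ * (N₂ : ℝ))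
    0 < δ →
    (p₁ * h₁ + p₂ * h₂ + q₁ / h₁ + q₂ / h₂
      = 1 + (1 - r) ^ 2 * (1 + r) * (N₁ : ℝ) * (N₂ : ℝ)
        * (((N₁ : ℝ) + (N₂ : ℝ) * r) * (r * (D₁ : ℝ) * (C₃ : ℝ)
            + (1 + r) * (D₂ : ℝ) * (C₃ : ℝ) + (D₂ : ℝ) * (C₄ : ℝ))
          + ((N₂ : ℝ) + (N₁ : ℝ) * r) * (r * (C₁ : ℝ) * (D₃ : ℝ)
            + (1 + r) * (C₂ : ℝ) * (D₃ : ℝ) + (C₂ : ℝ) * (D₄ : ℝ)))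
        / (δ * (N₁ : ℝ) * (N₂ : ℝ) * r * ((N₁ : ℝ) + (N₂ : ℝ) * r)
            * ((N₂ : ℝ) + (N₁ : ℝ) * r)) ∧
    p₁ * h₁ + p₂ * h₂ + q₁ / h₁ + q₂ / h₂ ≥ 1) := by
  intro h₁ h₂ δ p₁ p₂ q₁ q₂ hδ
  have hn : (0 : ℝ) < N₁ := by exact_mod_cast hN1
  have hm : (0 : ℝ) < N₂ := by exact_mod_cast hN2
  have H := aux r N₁ N₂ _ _ _ _ _ δ hr hn hm hδ rfl
    (aux2 r N₁ N₂ C₁ C₂ C₃ C₄ D₁ D₂ D₃ D₄ hr hn hm)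
  have H2 : p₁ * h₁ + p₂ * h₂ + q₁ / h₁ + q₂ / h₂
      = 1 + (1 - r) ^ 2 * (1 + r) * (N₁ : ℝ) * (N₂ : ℝ)
        * (((N₁ : ℝ) + (N₂ : ℝ) * r) * (r * (D₁ : ℝ) * (C₃ : ℝ)
            + (1 + r) * (D₂ : ℝ) * (C₃ : ℝ) + (D₂ : ℝ) * (C₄ : ℝ))
          + ((N₂ : ℝ) + (N₁ : ℝ) * r) * (r * (C₁ : ℝ) * (D₃ : ℝ)
            + (1 + r) * (C₂ : ℝ) * (D₃ : ℝ) + (C₂ : ℝ) * (D₄ : ℝ)))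
        / (δ * (N₁ : ℝ) * (N₂ : ℝ) * r * ((N₁ : ℝ) + (N₂ : ℝ) * r)
            * ((N₂ : ℝ) + (N₁ : ℝ) * r)) := by
    refine Eq.trans H ?_
    congr 2
    ring
  refine ⟨H2, ?_⟩
  rw [H2]
  clear_value δ
  have : 0 ≤ (1 - r) ^ 2 := sq_nonneg _
  apply le_add_of_nonneg_right
  positivity
end

section
/- Assume δ > 0. Then p₁h₁ + p₂h₂ + q₁/h₁ + q₂/h₂ > 1 if and only if r ≠ 1 and at least one of the six products D₁C₃, D₂C₃, D₂C₄, C₁D₃, C₂D₃, C₂D₄ is nonzero. (The strictness criterion for the submartingale step of Lemma 8, which drives the twelve-case analysis proving Eq. (4.15) in Theorem 9.) -/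
lemma key_aux (r δ u C₃ C₄ D₁ D₂ : ℝ) (hr : 0 < r) (hδ : 0 < δ) (hu : 0 < u) :
    (2 * r * D₁ + (1 + r) * D₂) * (C₃ + C₄) / δ * ((1 - r ^ 2) / (r * u))
    + ((1 + r) * C₃ + 2 * C₄) * (D₁ + D₂) / δ * ((r ^ 2 - 1) / u)
    = (1 - r) ^ 2 * ((1 + r) / δ *
      ((r * (C₃ * D₁) + (1 + r) * (C₃ * D₂) + C₄ * D₂) / (r * u))) := by
  field_simp
  ring

lemma key_id (r a b C₁ C₂ C₃ C₄ D₁ D₂ D₃ D₄ δ : ℝ) (hr : 0 < r) (ha : 0 < a) (hb : 0 < b)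
    (hδ : 0 < δ)
    (hd : δ = (1 / a) * ((2 * r * D₁ + (1 + r) * D₂) * (C₃ + C₄)
        + ((1 + r) * D₃ + 2 * D₄) * (C₁ + C₂))
      + (1 / b) * ((2 * r * C₁ + (1 + r) * C₂) * (D₃ + D₄)
        + ((1 + r) * C₃ + 2 * C₄) * (D₁ + D₂))) :
    (2 * r * D₁ + (1 + r) * D₂) * (C₃ + C₄) / (δ * a) * ((a + b * r) / (a * r ^ 2 + b * r))
    + (2 * r * C₁ + (1 + r) * C₂) * (D₃ + D₄) / (δ * b) * ((b + a * r) / (b * r ^ 2 + a * r))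
    + ((1 + r) * D₃ + 2 * D₄) * (C₁ + C₂) / (δ * a) / ((a + b * r) / (a * r ^ 2 + b * r))
    + ((1 + r) * C₃ + 2 * C₄) * (D₁ + D₂) / (δ * b) / ((b + a * r) / (b * r ^ 2 + a * r))
    = 1 + (1 - r) ^ 2 * ((1 + r) / δ *
      ((r * (D₁ * C₃) + (1 + r) * (D₂ * C₃) + D₂ * C₄) / (r * (a * r + b))
      + (r * (C₁ * D₃) + (1 + r) * (C₂ * D₃) + C₂ * D₄) / (r * (b * r + a)))) := by
  have h1 : (a + b * r) / (a * r ^ 2 + b * r) = 1 + a * ((1 - r ^ 2) / (r * (a * r + b))) := by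
    field_simp
    ring
  have h2 : (b + a * r) / (b * r ^ 2 + a * r) = 1 + b * ((1 - r ^ 2) / (r * (b * r + a))) := by
    field_simp
    ring
  have h3 : ((a + b * r) / (a * r ^ 2 + b * r))⁻¹ = 1 + a * ((r ^ 2 - 1) / (b * r + a)) := by
    rw [inv_div, add_comm a]
    field_simp
    ring
  have h4 : ((b + a * r) / (b * r ^ 2 + a * r))⁻¹ = 1 + b * ((r ^ 2 - 1) / (a * r + b)) := by
    rw [inv_div, add_comm b]
    field_simp
    ring
  rw [div_eq_mul_inv _ ((a + b * r) / _), div_eq_mul_inv _ ((b + a * r) / _), h3, h4, h1, h2]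
  have hu : 0 < a * r + b := by positivity
  have hv : 0 < b * r + a := by positivity
  generalize a * r + b = u at *
  generalize b * r + a = v at *
  have e : (2 * r * D₁ + (1 + r) * D₂) * (C₃ + C₄) / (δ * a)
    + (2 * r * C₁ + (1 + r) * C₂) * (D₃ + D₄) / (δ * b)
    + ((1 + r) * D₃ + 2 * D₄) * (C₁ + C₂) / (δ * a)
    + ((1 + r) * C₃ + 2 * C₄) * (D₁ + D₂) / (δ * b) = 1 := by
    clear h1 h2 h3 h4
    field_simp at hd ⊢
    linarith
  have m : ∀ P c X : ℝ, 0 < c → P / (δ * c) * (1 + c * X) = P / (δ * c) + P / δ * X := by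
    intro P c X hc
    field_simp
  rw [m _ a _ ha, m _ b _ hb, m _ a _ ha, m _ b _ hb]
  have t1 := key_aux r δ u C₃ C₄ D₁ D₂ hr hδ hu
  have t2 := key_aux r δ v D₃ D₄ C₁ C₂ hr hδ hv
  rw [mul_comm D₃ C₁, mul_comm D₃ C₂, mul_comm D₄ C₂] at t2
  rw [mul_comm C₃ D₁, mul_comm C₃ D₂, mul_comm C₄ D₂] at t1
  rw [mul_add ((1 + r) / δ), mul_add ((1 - r) ^ 2), ← t1, ← t2]
  refine Eq.trans ?_ (congrArg (· + _) e)
  abel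

/-- With `h₁`, `h₂`, `δ`, `p₁`, `p₂`, `q₁`, `q₂` as in
Eqs. (S6)–(S9) for the complete-bipartite layer, assuming `δ > 0`, one has
`p₁h₁ + p₂h₂ + q₁/h₁ + q₂/h₂ > 1` if and only if `r ≠ 1` and at least one of
the six products `D₁C₃, D₂C₃, D₂C₄, C₁D₃, C₂D₃, C₂D₄` is nonzero
(the strictness criterion for the submartingale step of Lemma 8). -/
theorem stmt12 (r : ℝ) (hr : 0 < r) (N₁ N₂ : ℕ) (hN1 : 1 ≤ N₁) (hN2 : 1 ≤ N₂)
    (C₁ C₂ C₃ C₄ D₁ D₂ D₃ D₄ : ℕ)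
    (hC : C₁ + C₂ + C₃ + C₄ = N₁) (hD : D₁ + D₂ + D₃ + D₄ = N₂) :
    let h₁ : ℝ := ((N₁ : ℝ) + (N₂ : ℝ) * r) / ((N₁ : ℝ) * r ^ 2 + (N₂ : ℝ) * r)
    let h₂ : ℝ := ((N₂ : ℝ) + (N₁ : ℝ) * r) / ((N₂ : ℝ) * r ^ 2 + (N₁ : ℝ) * r)
    let δ : ℝ := (1 / (N₁ : ℝ)) * ((2 * r * (D₁ : ℝ) + (1 + r) * (D₂ : ℝ)) * ((C₃ : ℝ) + (C₄ : ℝ))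
        + ((1 + r) * (D₃ : ℝ) + 2 * (D₄ : ℝ)) * ((C₁ : ℝ) + (C₂ : ℝ)))
      + (1 / (N₂ : ℝ)) * ((2 * r * (C₁ : ℝ) + (1 + r) * (C₂ : ℝ)) * ((D₃ : ℝ) + (D₄ : ℝ))
        + ((1 + r) * (C₃ : ℝ) + 2 * (C₄ : ℝ)) * ((D₁ : ℝ) + (D₂ : ℝ)))
    let p₁ : ℝ := (2 * r * (D₁ : ℝ) + (1 + r) * (D₂ : ℝ)) * ((C₃ : ℝ) + (C₄ : ℝ)) / (δ * (N₁ : ℝ))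
    let p₂ : ℝ := (2 * r * (C₁ : ℝ) + (1 + r) * (C₂ : ℝ)) * ((D₃ : ℝ) + (D₄ : ℝ)) / (δ * (N₂ : ℝ))
    let q₁ : ℝ := ((1 + r) * (D₃ : ℝ) + 2 * (D₄ : ℝ)) * ((C₁ : ℝ) + (C₂ : ℝ)) / (δ * (N₁ : ℝ))
    let q₂ : ℝ := ((1 + r) * (C₃ : ℝ) + 2 * (C₄ : ℝ)) * ((D₁ : ℝ) + (D₂ : ℝ)) / (δ * (N₂ : ℝ))
    0 < δ →
    (p₁ * h₁ + p₂ * h₂ + q₁ / h₁ + q₂ / h₂ > 1 ↔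
      r ≠ 1 ∧ (D₁ * C₃ ≠ 0 ∨ D₂ * C₃ ≠ 0 ∨ D₂ * C₄ ≠ 0 ∨
        C₁ * D₃ ≠ 0 ∨ C₂ * D₃ ≠ 0 ∨ C₂ * D₄ ≠ 0)) := by
  intro h₁ h₂ δ p₁ p₂ q₁ q₂ hδ
  have ha : (0 : ℝ) < N₁ := by exact_mod_cast hN1
  have hb : (0 : ℝ) < N₂ := by exact_mod_cast hN2
  have key := key_id r N₁ N₂ C₁ C₂ C₃ C₄ D₁ D₂ D₃ D₄ δ hr ha hb hδ rfl
  change p₁ * h₁ + p₂ * h₂ + q₁ / h₁ + q₂ / h₂ = _ at key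
  rw [key]
  clear key
  clear_value δ
  constructor
  · intro h
    refine ⟨?_, ?_⟩
    · rintro rfl
      simp at h
    · by_contra hc
      push Not at hc
      obtain ⟨x1, x2, x3, x4, x5, x6⟩ := hc
      have y1 : (D₁ : ℝ) * C₃ = 0 := by exact_mod_cast x1
      have y2 : (D₂ : ℝ) * C₃ = 0 := by exact_mod_cast x2
      have y3 : (D₂ : ℝ) * C₄ = 0 := by exact_mod_cast x3
      have y4 : (C₁ : ℝ) * D₃ = 0 := by exact_mod_cast x4
      have y5 : (C₂ : ℝ) * D₃ = 0 := by exact_mod_cast x5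
      have y6 : (C₂ : ℝ) * D₄ = 0 := by exact_mod_cast x6
      rw [y1, y2, y3, y4, y5, y6] at h
      simp at h
  · rintro ⟨h1, h⟩
    have hs : 0 < (1 - r) ^ 2 := by
      have : 1 - r ≠ 0 := sub_ne_zero.mpr (Ne.symm h1)
      positivity
    have pos : ∀ m n : ℕ, m * n ≠ 0 → (0 : ℝ) < (m : ℝ) * n := fun m n h => by
      exact_mod_cast Nat.pos_of_ne_zero h
    refine lt_add_of_pos_right _ (mul_pos hs (mul_pos (by positivity) ?_))
    rcases h with h | h | h | h | h | h <;> have := pos _ _ h <;>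
      generalize ((_ : ℕ) : ℝ) * _ = z at this <;> positivity
end
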